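/- arXiv:2003.06177 — 7 statements merged into one kernel-verified Lean document; each statement's English description precedes it below -/
import Mathlib

section
/- For integers n ≥ 1 and k ≥ 1, the ℚ-linear span of the set of all n×k matrices over ℚ whose entries are 0 or 1 and which have exactly one 1 in each row has dimension n(k-1)+1. -/
/-- An `n × k` matrix of word: a matrix over `ℚ` with entries `0` or `1` and exactly one `1`
in each row. -/
def IsWordMatrixNK {n k : ℕ} (M : Matrix (Fin n) (Fin k) ℚ) : Prop :=
  ∃ f : Fin n → Fin k, ∀ p r, M p r = if f p = r then 1 else 0

open Finset in
/-- The linear parametrization of the `n × (m + 1)` matrices all of whose rows have the same sum: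
`(a, c)` gives the matrix with row sums `c` whose columns of positive index are those of `a`. -/
def constRowSumMap (n m : ℕ) :
    ((Fin n × Fin m → ℚ) × ℚ) →ₗ[ℚ] Matrix (Fin n) (Fin (m + 1)) ℚ where
  toFun x := Matrix.of fun p =>
    Fin.cons (x.2 - ∑ r, x.1 (p, r)) fun r => x.1 (p, r)
  map_add' x y := by
    ext p r
    refine Fin.cases ?_ (fun r => ?_) r
    · simp [sum_add_distrib]
      ring
    · simp
  map_smul' c x := by
    ext p r
    refine Fin.cases ?_ (fun r => ?_) r
    · simp [mul_sum, mul_sub]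
    · simp

@[simp]
theorem constRowSumMap_apply_zero {n m : ℕ} (x : (Fin n × Fin m → ℚ) × ℚ) (p : Fin n) :
    constRowSumMap n m x p 0 = x.2 - ∑ r, x.1 (p, r) := rfl

@[simp]
theorem constRowSumMap_apply_succ {n m : ℕ} (x : (Fin n × Fin m → ℚ) × ℚ) (p : Fin n)
    (r : Fin m) : constRowSumMap n m x p r.succ = x.1 (p, r) := rfl

theorem constRowSumMap_injective {n : ℕ} (hn : 1 ≤ n) (m : ℕ) :
    Function.Injective (constRowSumMap n m) := by
  intro x y h
  have h₁ : x.1 = y.1 := by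
    ext ⟨p, r⟩
    simpa using congrFun (congrFun h p) r.succ
  refine Prod.ext h₁ ?_
  simpa [h₁] using congrFun (congrFun h ⟨0, hn⟩) 0

theorem IsWordMatrixNK.mem_range_constRowSumMap {n m : ℕ} {M : Matrix (Fin n) (Fin (m + 1)) ℚ}
    (hM : IsWordMatrixNK M) : M ∈ LinearMap.range (constRowSumMap n m) := by
  obtain ⟨f, hf⟩ := hM
  refine ⟨(fun q => M q.1 q.2.succ, 1), ?_⟩
  ext p r
  refine Fin.cases ?_ (fun r => ?_) r
  · have h : ∑ r, M p r = 1 := by simp [hf]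
    rw [Fin.sum_univ_succ] at h
    simp only [constRowSumMap_apply_zero]
    linarith
  · simp

theorem constRowSumMap_zero_one_mem_span (n m : ℕ) :
    constRowSumMap n m (0, 1) ∈
      Submodule.span ℚ {M : Matrix (Fin n) (Fin (m + 1)) ℚ | IsWordMatrixNK M} := by
  refine Submodule.subset_span ⟨fun _ => 0, fun p r => ?_⟩
  refine Fin.cases ?_ (fun r => ?_) r
  · simp
  · simp [(Fin.succ_ne_zero r).symm]

theorem constRowSumMap_single_one_mem_span {n m : ℕ} (q : Fin n × Fin m) :
    constRowSumMap n m (Pi.single q 1, 1) ∈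
      Submodule.span ℚ {M : Matrix (Fin n) (Fin (m + 1)) ℚ | IsWordMatrixNK M} := by
  obtain ⟨p₀, r₀⟩ := q
  refine Submodule.subset_span ⟨fun p => if p = p₀ then r₀.succ else 0, fun p r => ?_⟩
  refine Fin.cases ?_ (fun r => ?_) r
  · by_cases h : p = p₀ <;> simp [Pi.single_apply, h]
  · by_cases h : p = p₀ <;>
      simp [Pi.single_apply, h, (Fin.succ_ne_zero r).symm, @eq_comm _ r₀ r]

theorem span_wordMatrices_eq_range (n m : ℕ) :
    Submodule.span ℚ {M : Matrix (Fin n) (Fin (m + 1)) ℚ | IsWordMatrixNK M} =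
      LinearMap.range (constRowSumMap n m) := by
  refine le_antisymm (Submodule.span_le.2 fun M hM => hM.mem_range_constRowSumMap) ?_
  rintro _ ⟨⟨a, c⟩, rfl⟩
  have hdecomp : ((a, c) : (Fin n × Fin m → ℚ) × ℚ) =
      c • (0, 1) + ∑ q, a q • ((Pi.single q 1, 1) - (0, 1)) := by
    refine Prod.ext ?_ ?_
    · ext q
      simp [Prod.fst_sum, Pi.single_apply]
    · simp [Prod.snd_sum]
  rw [hdecomp, map_add, map_smul, map_sum]
  refine add_mem (Submodule.smul_mem _ _ (constRowSumMap_zero_one_mem_span n m))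
    (sum_mem fun q _ => ?_)
  rw [map_smul, map_sub]
  exact Submodule.smul_mem _ _
    (sub_mem (constRowSumMap_single_one_mem_span q) (constRowSumMap_zero_one_mem_span n m))

/-- The `ℚ`-span of the set of all `n × k` matrices of word has dimension `n(k-1)+1`. -/
theorem finrank_span_wordMatrices {n k : ℕ} (hn : 1 ≤ n) (hk : 1 ≤ k) :
    Module.finrank ℚ
      ↥(Submodule.span ℚ {M : Matrix (Fin n) (Fin k) ℚ | IsWordMatrixNK M}) =
      n * (k - 1) + 1 := by
  obtain ⟨m, rfl⟩ := Nat.exists_eq_add_of_le' hk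
  rw [span_wordMatrices_eq_range, LinearMap.finrank_range_of_inj (constRowSumMap_injective hn m)]
  simp
end

section
/- For n ≥ 2 and a fixed column index c, the ℚ-linear span of the set of all Q×Q word matrices (|Q| = n) whose column c is identically zero has dimension (n-1)^2. -/
/-- A word matrix: a `Q × Q` matrix over `ℚ` with entries `0` or `1` and exactly one `1`
in each row. -/
def IsWordMatrix {Q : Type*} [DecidableEq Q] (M : Matrix Q Q ℚ) : Prop :=
  ∃ f : Q → Q, ∀ p r : Q, M p r = if f p = r then 1 else 0

namespace WordMatrix

variable {Q : Type*} [DecidableEq Q]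

/-- The word matrix of the map `f`. -/
def ofMap (f : Q → Q) : Matrix Q Q ℚ := fun p r => if f p = r then 1 else 0

/-- The difference of two word matrices that differ in row `p` only, where the first has its `1`
in column `r` and the second in column `d`. -/
def rowDiff (d p r : Q) : Matrix Q Q ℚ := Matrix.single p r 1 - Matrix.single p d 1

/-- A basis of the span of the word matrices whose column `c` is zero, for `d ≠ c`. -/
def basisFamily [Fintype Q] (c d : Q) :
    Option (Q × ↥(({c, d} : Finset Q)ᶜ)) → Matrix Q Q ℚ
  | none => ofMap fun _ => d
  | some x => rowDiff d x.1 x.2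

theorem ofMap_eq_add_sum [Fintype Q] (d : Q) (f : Q → Q) :
    ofMap f = ofMap (fun _ => d) + ∑ p, rowDiff d p (f p) := by
  ext p r
  simp [ofMap, rowDiff, Matrix.sum_apply, Matrix.single_apply, ite_and]

theorem rowDiff_eq_sub (d p r : Q) :
    rowDiff d p r = ofMap (Function.update (fun _ => d) p r) - ofMap fun _ => d := by
  ext q s
  by_cases h : q = p
  · subst h
    simp [ofMap, rowDiff, Matrix.single_apply]
  · simp [ofMap, rowDiff, h, Ne.symm h]

theorem rowDiff_mem_span [Fintype Q] {c d : Q} (p : Q) {r : Q} (hr : r ≠ c) :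
    rowDiff d p r ∈ Submodule.span ℚ (Set.range (basisFamily c d)) := by
  by_cases h : r = d
  · simp [rowDiff, h]
  · exact Submodule.subset_span ⟨some (p, ⟨r, by simp [hr, h]⟩), rfl⟩

theorem ofMap_mem {c : Q} {f : Q → Q} (hf : ∀ p, f p ≠ c) :
    ofMap f ∈ {M : Matrix Q Q ℚ | IsWordMatrix M ∧ ∀ p : Q, M p c = 0} :=
  ⟨⟨f, fun _ _ => rfl⟩, fun p => if_neg (hf p)⟩

theorem span_zero_column_eq [Fintype Q] {c d : Q} (hd : d ≠ c) :
    Submodule.span ℚ {M : Matrix Q Q ℚ | IsWordMatrix M ∧ ∀ p : Q, M p c = 0} =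
      Submodule.span ℚ (Set.range (basisFamily c d)) := by
  apply le_antisymm <;> rw [Submodule.span_le]
  · rintro M ⟨⟨f, hf⟩, hc⟩
    have hM : M = ofMap f := by
      ext p r
      exact hf p r
    rw [hM, ofMap_eq_add_sum d]
    refine add_mem (Submodule.subset_span ⟨none, rfl⟩) (sum_mem fun p _ => rowDiff_mem_span p ?_)
    intro h
    simpa [hf, h] using hc p
  · have hconst := Submodule.subset_span (R := ℚ) (ofMap_mem (f := fun _ : Q => d) fun _ => hd)
    rintro _ ⟨_ | ⟨p, r, hr⟩, rfl⟩
    · exact hconst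
    · change rowDiff d p r ∈ _
      rw [rowDiff_eq_sub]
      refine sub_mem (Submodule.subset_span (ofMap_mem fun q => ?_)) hconst
      simp only [Finset.mem_compl, Finset.mem_insert, Finset.mem_singleton, not_or] at hr
      by_cases h : q = p
      · simpa [h] using hr.1
      · simpa [h] using hd

theorem linearIndependent_basisFamily [Fintype Q] (c d : Q) :
    LinearIndependent ℚ (basisFamily c d) := by
  rw [Fintype.linearIndependent_iff]
  intro g hg
  rw [Fintype.sum_option] at hg
  have hsome (x : Q × ↥(({c, d} : Finset Q)ᶜ)) : g (some x) = 0 := by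
    obtain ⟨p, r, hr⟩ := x
    have hrd : d ≠ r := by
      rintro rfl
      simp at hr
    have h := congrFun (congrFun hg p) r
    simp only [basisFamily, ofMap, rowDiff, Matrix.add_apply, Matrix.sum_apply, Matrix.smul_apply,
      Matrix.sub_apply, Matrix.single_apply, hrd, and_false, if_false, smul_eq_mul, mul_zero,
      zero_add, sub_zero, Matrix.zero_apply] at h
    rw [Finset.sum_eq_single (p, ⟨r, hr⟩)] at h
    · simpa using h
    · rintro ⟨q, s, hs⟩ _ hne
      rw [if_neg, mul_zero]
      rintro ⟨rfl, rfl⟩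
      exact hne rfl
    · simp
  rintro (_ | x)
  · have h := congrFun (congrFun hg c) d
    simpa [hsome, basisFamily, ofMap] using h
  · exact hsome x

end WordMatrix

/-- For `n ≥ 2`, the `ℚ`-span of the set of word matrices whose column `c` is identically
zero has dimension `(n-1)^2`. -/
theorem finrank_span_wordMatrices_zero_column {Q : Type*} [Fintype Q] [DecidableEq Q]
    (hn : 2 ≤ Fintype.card Q) (c : Q) :
    Module.finrank ℚ
      ↥(Submodule.span ℚ {M : Matrix Q Q ℚ | IsWordMatrix M ∧ ∀ p : Q, M p c = 0}) =
      (Fintype.card Q - 1) ^ 2 := by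
  have : Nontrivial Q := Fintype.one_lt_card_iff_nontrivial.mp hn
  obtain ⟨d, hd⟩ := exists_ne c
  rw [WordMatrix.span_zero_column_eq hd,
    finrank_span_eq_card (WordMatrix.linearIndependent_basisFamily c d), Fintype.card_option,
    Fintype.card_prod, Fintype.card_coe, Finset.card_compl, Finset.card_pair hd.symm]
  obtain ⟨k, hk⟩ := Nat.exists_eq_add_of_le' hn
  rw [hk, Nat.add_sub_cancel, show k + 2 - 1 = k + 1 from rfl]
  ring
end

section
/- Any ℚ-linearly independent family of Q×Q word matrices, where |Q| = n, has at most n(n-1)+1 members. -/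
/-- Every row of a word matrix sums to `1`. -/
theorem IsWordMatrix.sum_row {Q : Type*} [Fintype Q] [DecidableEq Q] {M : Matrix Q Q ℚ}
    (hM : IsWordMatrix M) (p : Q) : ∑ r, M p r = 1 := by
  obtain ⟨f, hf⟩ := hM
  simp [hf]

/-- A linear dependence among the entries of word matrices outside the column `q`, whose
coefficients sum to zero, is a linear dependence among the word matrices. -/
theorem sum_smul_wordMatrices_eq_zero {Q : Type*} [Fintype Q] [DecidableEq Q] (q : Q)
    {ι : Type*} [Fintype ι] (A : ι → Matrix Q Q ℚ) (hA : ∀ i, IsWordMatrix (A i)) (c : ι → ℚ)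
    (hc : ∑ i, c i = 0) (hentry : ∀ p r, r ≠ q → ∑ i, c i * A i p r = 0) :
    ∑ i, c i • A i = 0 := by
  ext p r
  simp only [Matrix.sum_apply, Matrix.smul_apply, smul_eq_mul, Matrix.zero_apply]
  by_cases hr : r = q
  · have hrow : ∑ r', ∑ i, c i * A i p r' = 0 := by
      rw [Finset.sum_comm]
      simp only [← Finset.mul_sum, (hA _).sum_row, mul_one, hc]
    rwa [Finset.sum_eq_single r (fun r' _ h => hentry p r' (hr ▸ h)) (by simp)] at hrow
  · exact hentry p r hr

/-- Any `ℚ`-linearly independent family of `Q × Q` word matrices, `|Q| = n`, has at most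
`n(n-1)+1` members. -/
theorem card_linearIndependent_wordMatrices {Q : Type*} [Fintype Q] [DecidableEq Q]
    [Nonempty Q] {ι : Type*} [Fintype ι] (A : ι → Matrix Q Q ℚ)
    (hA : ∀ i, IsWordMatrix (A i)) (hli : LinearIndependent ℚ A) :
    Fintype.card ι ≤ Fintype.card Q * (Fintype.card Q - 1) + 1 := by
  obtain ⟨q⟩ := ‹Nonempty Q›
  let v : ι → Option (Q × {r : Q // r ≠ q}) → ℚ :=
    fun i x => x.elim 1 fun y => A i y.1 y.2
  have hv : LinearIndependent ℚ v := by
    rw [Fintype.linearIndependent_iff] at hli ⊢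
    intro c hc
    refine hli c (sum_smul_wordMatrices_eq_zero q A hA c ?_ fun p r hr => ?_)
    · simpa [v] using congrFun hc none
    · simpa [v] using congrFun hc (some (p, ⟨r, hr⟩))
  simpa [Fintype.card_subtype_compl] using hv.fintype_card_le_finrank
end

section
/- Let s be a synchronizing word with δ*(s)(p) = q for all p ∈ Q, and let u be any word. Then a word matrix L satisfies the equation M_u L = M_s if and only if L_{j,q} = 1 for every j in R(u) (the image of δ*(u)). Consequently solutions L exist for every u, and the minimal number of 1s in column q over all solutions L of M_u L = M_s equals |R(u)|. -/
/-- The state reached from `p` after reading the word `u` (letters applied left to right). -/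
def dfaRun {Q A : Type*} (δ : A → Q → Q) (u : List A) (p : Q) : Q :=
  u.foldl (fun st a => δ a st) p

/-- The matrix `M_u` of the word `u`: `(M_u)_{p,r} = 1` if `δ*(u)(p) = r` and `0` otherwise. -/
def wordMat {Q A : Type*} [DecidableEq Q] (δ : A → Q → Q) (u : List A) : Matrix Q Q ℚ :=
  fun p r => if dfaRun δ u p = r then 1 else 0

theorem wordMat_mul_apply {Q A : Type*} [Fintype Q] [DecidableEq Q] (δ : A → Q → Q)
    (u : List A) (L : Matrix Q Q ℚ) (p r : Q) :
    (wordMat δ u * L) p r = L (dfaRun δ u p) r := by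
  simp [Matrix.mul_apply, wordMat]

theorem IsWordMatrix.wordMat_mul_eq_iff {Q A : Type*} [Fintype Q] [DecidableEq Q]
    {δ : A → Q → Q} {s : List A} {q : Q} (hs : ∀ p : Q, dfaRun δ s p = q) (u : List A)
    {L : Matrix Q Q ℚ} (hL : IsWordMatrix L) :
    wordMat δ u * L = wordMat δ s ↔ ∀ j ∈ Finset.univ.image (dfaRun δ u), L j q = 1 := by
  obtain ⟨f, hf⟩ := hL
  simp only [← Matrix.ext_iff, wordMat_mul_apply, Finset.forall_mem_image, Finset.mem_univ,
    true_imp_iff]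
  constructor
  · intro h p
    rw [h p q, wordMat, hs, if_pos rfl]
  · intro h p r
    have hp : f (dfaRun δ u p) = q := by
      have := @h p
      rw [hf] at this
      by_contra hne
      simp [hne] at this
    rw [hf, hp, wordMat, hs]

/-- Every nonempty finset `R` is the set of rows whose unit lies in column `q`,
for some word matrix. -/
theorem exists_isWordMatrix_apply_eq_one_iff {Q : Type*} [DecidableEq Q] (q : Q)
    {R : Finset Q} (hR : R.Nonempty) :
    ∃ L : Matrix Q Q ℚ, IsWordMatrix L ∧ ∀ j, L j q = 1 ↔ j ∈ R := by
  have hf : ∃ f : Q → Q, ∀ j, f j = q ↔ j ∈ R := by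
    by_cases h : ∃ k, k ∉ R
    · obtain ⟨k, hk⟩ := h
      obtain ⟨j, hj⟩ := hR
      have : Nontrivial Q := ⟨j, k, fun h => hk (h ▸ hj)⟩
      obtain ⟨r, hr⟩ := exists_ne q
      refine ⟨fun j => if j ∈ R then q else r, fun j => ?_⟩
      by_cases hj : j ∈ R <;> simp [hj, hr]
    · push Not at h
      exact ⟨fun _ => q, fun j => by simp [h j]⟩
  obtain ⟨f, hf⟩ := hf
  exact ⟨fun p r => if f p = r then 1 else 0, ⟨f, fun _ _ => rfl⟩, fun j => by simp [hf]⟩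

/-- Solutions of `M_u L = M_s` for a synchronizing word `s` with target state `q` are exactly
the word matrices with `L_{j,q} = 1` for every `j` in the image of `δ*(u)`; solutions exist,
and the minimal number of units in column `q` over all solutions is `|R(u)|`. -/
theorem solutions_of_matrix_equation {Q A : Type*} [Fintype Q] [DecidableEq Q] [Nonempty Q]
    (δ : A → Q → Q) (s : List A) (q : Q) (hs : ∀ p : Q, dfaRun δ s p = q) (u : List A) :
    (∀ L : Matrix Q Q ℚ, IsWordMatrix L →
      (wordMat δ u * L = wordMat δ s ↔
        ∀ j ∈ Finset.univ.image (dfaRun δ u), L j q = 1)) ∧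
    (∃ L : Matrix Q Q ℚ, IsWordMatrix L ∧ wordMat δ u * L = wordMat δ s) ∧
    IsLeast {m : ℕ | ∃ L : Matrix Q Q ℚ, IsWordMatrix L ∧ wordMat δ u * L = wordMat δ s ∧
        m = (Finset.univ.filter fun j => L j q = 1).card}
      (Finset.univ.image (dfaRun δ u)).card := by
  obtain ⟨L, hL, hLq⟩ := exists_isWordMatrix_apply_eq_one_iff q
    (Finset.univ_nonempty.image (dfaRun δ u))
  have hsol : wordMat δ u * L = wordMat δ s :=
    (hL.wordMat_mul_eq_iff hs u).2 fun j hj => (hLq j).2 hj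
  refine ⟨fun L hL => hL.wordMat_mul_eq_iff hs u, ⟨L, hL, hsol⟩, ⟨L, hL, hsol, ?_⟩, ?_⟩
  · congr 1
    ext j
    rw [Finset.mem_filter_univ, hLq]
  · rintro m ⟨L', hL', hsol', rfl⟩
    exact Finset.card_le_card fun j hj =>
      Finset.mem_filter.2 ⟨Finset.mem_univ j, (hL'.wordMat_mul_eq_iff hs u).1 hsol' j hj⟩
end

section
/- Let s be a synchronizing word with δ*(s)(p) = q for all p ∈ Q, let u be a word and β ∈ Σ a letter, and let L be a word matrix with M_u L = M_s. Then there exists a word matrix B which is a right pseudoinverse of M_β such that M_u M_β B L = M_s; that is, B·L is a solution of the equation M_{uβ} X = M_s. -/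
/-- A word matrix `B` is a right pseudoinverse of the matrix of the mapping `g` if for every
state `j` in the image of `g`, the unique unit in row `j` of `B` lies in a column `i`
with `g i = j`. -/
def IsRightPseudoinverse {Q : Type*} [DecidableEq Q] (B : Matrix Q Q ℚ) (g : Q → Q) : Prop :=
  IsWordMatrix B ∧ ∀ j : Q, (∃ p, g p = j) → ∀ i : Q, B j i = 1 → g i = j

/-- The 0-1 matrix of a map `f`, with the unit of row `p` in column `f p`. -/
def mapMat {Q : Type*} [DecidableEq Q] (f : Q → Q) : Matrix Q Q ℚ :=
  fun p r => if f p = r then 1 else 0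

theorem mapMat_mul {Q : Type*} [Fintype Q] [DecidableEq Q] (f g : Q → Q) :
    mapMat f * mapMat g = mapMat (g ∘ f) := by
  ext p r
  simp only [Matrix.mul_apply, mapMat, ite_mul, one_mul, zero_mul, Finset.sum_ite_eq,
    Finset.mem_univ, if_true, Function.comp_apply]

theorem mapMat_injective {Q : Type*} [DecidableEq Q] :
    Function.Injective (mapMat : (Q → Q) → Matrix Q Q ℚ) := by
  intro f g h
  funext p
  have hp := congrFun (congrFun h p) (f p)
  by_contra hne
  simp [mapMat, Ne.symm hne] at hp

theorem wordMat_eq_mapMat {Q A : Type*} [DecidableEq Q] (δ : A → Q → Q) (u : List A) :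
    wordMat δ u = mapMat (dfaRun δ u) := rfl

theorem wordMat_append {Q A : Type*} [Fintype Q] [DecidableEq Q] (δ : A → Q → Q)
    (u v : List A) : wordMat δ (u ++ v) = wordMat δ u * wordMat δ v := by
  simp only [wordMat_eq_mapMat, mapMat_mul]
  congr 1
  funext p
  simp [dfaRun]

/-- A map `g` has a section on its image which, on the image of `g ∘ h`, takes values in
the image of `h`. -/
theorem exists_section_through {Q : Type*} (g h : Q → Q) :
    ∃ b : Q → Q, (∀ p, g (b (g p)) = g p) ∧ ∀ p, ∃ p', b (g (h p)) = h p' := by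
  have key : ∀ j : Q, ∃ i : Q, ((∃ p, g p = j) → g i = j) ∧
      ((∃ p, g (h p) = j) → ∃ p', i = h p') := by
    intro j
    by_cases hgh : ∃ p, g (h p) = j
    · obtain ⟨p, hp⟩ := hgh
      exact ⟨h p, fun _ => hp, fun _ => ⟨p, rfl⟩⟩
    · by_cases hg : ∃ p, g p = j
      · obtain ⟨p, hp⟩ := hg
        exact ⟨p, fun _ => hp, fun h' => absurd h' hgh⟩
      · exact ⟨j, fun h' => absurd h' hg, fun h' => absurd h' hgh⟩
  choose b hb using key
  exact ⟨b, fun p => (hb (g p)).1 ⟨p, rfl⟩, fun p => (hb (g (h p))).2 ⟨p, rfl⟩⟩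

/-- For every solution `L` of `M_u L = M_s` and every letter `β` there is a right
pseudoinverse `B` of `M_β` such that `B·L` solves `M_{uβ} X = M_s`. -/
theorem pseudoinverse_solution {Q A : Type*} [Fintype Q] [DecidableEq Q] [Nonempty Q]
    (δ : A → Q → Q) (s : List A) (q : Q) (hs : ∀ p : Q, dfaRun δ s p = q)
    (u : List A) (β : A) (L : Matrix Q Q ℚ) (hL : IsWordMatrix L)
    (hLs : wordMat δ u * L = wordMat δ s) :
    ∃ B : Matrix Q Q ℚ, IsRightPseudoinverse B (δ β) ∧
      wordMat δ u * wordMat δ [β] * (B * L) = wordMat δ s ∧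
      wordMat δ (u ++ [β]) * (B * L) = wordMat δ s := by
  obtain ⟨f, hf⟩ := hL
  obtain rfl : L = mapMat f := by
    ext p r
    exact hf p r
  have hfu : ∀ p, f (dfaRun δ u p) = q := by
    intro p
    rw [wordMat_eq_mapMat, wordMat_eq_mapMat, mapMat_mul] at hLs
    exact (congrFun (mapMat_injective hLs) p).trans (hs p)
  obtain ⟨b, hb, hbu⟩ := exists_section_through (δ β) (dfaRun δ u)
  have hsol : wordMat δ u * wordMat δ [β] * (mapMat b * mapMat f) = wordMat δ s := by
    simp only [wordMat_eq_mapMat, mapMat_mul]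
    congr 1
    funext p
    obtain ⟨p', hp'⟩ := hbu p
    change f (b (δ β (dfaRun δ u p))) = dfaRun δ s p
    rw [hp', hfu, hs]
  refine ⟨mapMat b, ⟨⟨b, fun _ _ => rfl⟩, ?_⟩, hsol, by rw [wordMat_append, hsol]⟩
  rintro _ ⟨p, rfl⟩ i hi
  have hbi : b (δ β p) = i := by
    by_contra hne
    simp [mapMat, hne] at hi
  rw [← hbi, hb]
end

section
/- Let A be a DFA with n states and let I ⊆ Q be a nonempty subset that is closed under every letter (δ(α)(I) ⊆ I for all α ∈ Σ) and reachable from every state (for every p ∈ Q there is a word w with δ*(w)(p) ∈ I). Set m = n - |I|. Then there exists a word v of length at most m(m+1)/2 such that δ*(v)(p) ∈ I for every state p ∈ Q. -/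
theorem dfaRun_append {Q A : Type*} (δ : A → Q → Q) (u v : List A) (p : Q) :
    dfaRun δ (u ++ v) p = dfaRun δ v (dfaRun δ u p) := by
  simp [dfaRun]

theorem dfaRun_mem_of_closed {Q A : Type*} {δ : A → Q → Q} {S : Finset Q}
    (hS : ∀ α : A, ∀ p ∈ S, δ α p ∈ S) (u : List A) {p : Q} (hp : p ∈ S) :
    dfaRun δ u p ∈ S := by
  induction u generalizing p with
  | nil => exact hp
  | cons a u ih => exact ih (hS a p hp)

/-- Among the states of a nonempty set `S` disjoint from `I`, some state is sent into `I` by a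
word of length at most `|Iᶜ| + 1 - |S|`. -/
theorem exists_short_word_into {Q A : Type*} [Fintype Q] [DecidableEq Q]
    {δ : A → Q → Q} {I : Finset Q} (hreach : ∀ p : Q, ∃ w : List A, dfaRun δ w p ∈ I)
    (S : Finset Q) (hS : S.Nonempty) (hSI : S ⊆ Iᶜ) :
    ∃ p ∈ S, ∃ w : List A, dfaRun δ w p ∈ I ∧ w.length + S.card ≤ Iᶜ.card + 1 := by
  induction hd : Iᶜ.card - S.card using Nat.strong_induction_on generalizing S with
  | _ d ih =>
    have hcard := Finset.card_le_card hSI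
    obtain ⟨a, p, hp, hap⟩ : ∃ a : A, ∃ p ∈ S, δ a p ∉ S := by
      by_contra! hclosed
      obtain ⟨p, hp⟩ := hS
      obtain ⟨w, hw⟩ := hreach p
      exact Finset.mem_compl.mp (hSI (dfaRun_mem_of_closed hclosed w hp)) hw
    by_cases hI : δ a p ∈ I
    · exact ⟨p, hp, [a], hI, by simp only [List.length_singleton]; omega⟩
    · have hsub : insert (δ a p) S ⊆ Iᶜ :=
        Finset.insert_subset (Finset.mem_compl.mpr hI) hSI
      have hle := Finset.card_le_card hsub
      have hins := Finset.card_insert_of_notMem hap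
      obtain ⟨q, hq, w, hw, hlen⟩ :=
        ih _ (by omega) _ (Finset.insert_nonempty _ _) hsub rfl
      rcases Finset.mem_insert.mp hq with rfl | hq
      · exact ⟨p, hp, a :: w, hw, by simp only [List.length_cons]; omega⟩
      · exact ⟨q, hq, w, hw, by omega⟩

theorem exists_word_mapping_into {Q A : Type*} [Fintype Q] [DecidableEq Q]
    {δ : A → Q → Q} {I : Finset Q} (hclosed : ∀ α : A, ∀ p ∈ I, δ α p ∈ I)
    (hreach : ∀ p : Q, ∃ w : List A, dfaRun δ w p ∈ I) (k : ℕ) (hk : k ≤ Iᶜ.card)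
    (S : Finset Q) (hSI : S ⊆ Iᶜ) (hSk : S.card ≤ k) :
    ∃ v : List A, 2 * v.length + k * k ≤ 2 * k * Iᶜ.card + k ∧ ∀ p ∈ S, dfaRun δ v p ∈ I := by
  induction k generalizing S with
  | zero =>
    obtain rfl : S = ∅ := Finset.card_eq_zero.mp (Nat.le_zero.mp hSk)
    exact ⟨[], by simp⟩
  | succ k ih =>
    rcases Nat.lt_or_ge k S.card with hlt | hge
    · obtain ⟨p, hp, w, hw, hlen⟩ :=
        exists_short_word_into hreach S (Finset.card_pos.mp (by omega)) hSI
      have hsub : (S.image (dfaRun δ w)).filter (· ∉ I) ⊆ (S.erase p).image (dfaRun δ w) := by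
        intro q hq
        obtain ⟨hq, hqI⟩ := Finset.mem_filter.mp hq
        obtain ⟨r, hr, rfl⟩ := Finset.mem_image.mp hq
        refine Finset.mem_image_of_mem _ (Finset.mem_erase.mpr ⟨?_, hr⟩)
        rintro rfl
        exact hqI hw
      have hcard := (Finset.card_le_card hsub).trans Finset.card_image_le
      rw [Finset.card_erase_of_mem hp] at hcard
      obtain ⟨v, hv, hvI⟩ := ih (by omega)
        ((S.image (dfaRun δ w)).filter (· ∉ I))
        (fun q hq => Finset.mem_compl.mpr (Finset.mem_filter.mp hq).2) (by omega)
      refine ⟨w ++ v, ?_, fun q hq => ?_⟩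
      · rw [List.length_append]
        have : w.length + k ≤ Iᶜ.card := by omega
        nlinarith
      · rw [dfaRun_append]
        by_cases hqI : dfaRun δ w q ∈ I
        · exact dfaRun_mem_of_closed hclosed v hqI
        · exact hvI _ (Finset.mem_filter.mpr ⟨Finset.mem_image_of_mem _ hq, hqI⟩)
    · obtain ⟨v, hv, hvI⟩ := ih (by omega) S hSI hge
      exact ⟨v, by nlinarith, hvI⟩

/-- If `I` is a nonempty subset of states closed under every letter and reachable from every
state, and `m = n - |I|`, then some word `v` of length at most `m(m+1)/2` sends every state
into `I`. -/
theorem word_into_ideal {Q A : Type*} [Fintype Q] [DecidableEq Q] [Nonempty Q]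
    (δ : A → Q → Q) (I : Finset Q) (hne : I.Nonempty)
    (hclosed : ∀ α : A, ∀ p ∈ I, δ α p ∈ I)
    (hreach : ∀ p : Q, ∃ w : List A, dfaRun δ w p ∈ I) :
    ∃ v : List A,
      v.length ≤ (Fintype.card Q - I.card) * (Fintype.card Q - I.card + 1) / 2 ∧
      ∀ p : Q, dfaRun δ v p ∈ I := by
  obtain ⟨v, hv, hvI⟩ := exists_word_mapping_into hclosed hreach _ le_rfl Iᶜ subset_rfl le_rfl
  rw [← Finset.card_compl]
  refine ⟨v, ?_, fun p => ?_⟩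
  · rw [Nat.le_div_iff_mul_le two_pos]
    nlinarith
  · by_cases hp : p ∈ I
    · exact dfaRun_mem_of_closed hclosed v hp
    · exact hvI p (Finset.mem_compl.mpr hp)
end

section
/- For n ≥ 2, consider the Černý automaton: the DFA with state set ZMod n and two letters a, b, where δ(a)(i) = i + 1 and δ(b)(0) = 1, δ(b)(i) = i for i ≠ 0. Then the word b(a^{n-1}b)^{n-2} is a synchronizing word of length (n-1)^2, and every synchronizing word of this automaton has length at least (n-1)^2. -/
/-- The transition function of the Černý automaton on `ZMod n` with two letters:
`true` (the letter `a`) sends `i` to `i + 1`; `false` (the letter `b`) fixes every state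
except `0`, which it sends to `1`. -/
def cernyδ (n : ℕ) : Bool → ZMod n → ZMod n :=
  fun x i => match x with
    | true => i + 1
    | false => if i = 0 then 1 else i

/-- The word `b (a^{n-1} b)^{n-2}` of the Černý automaton. -/
def cernyWord (n : ℕ) : List Bool :=
  false :: (List.replicate (n - 2) (List.replicate (n - 1) true ++ [false])).flatten

theorem dfaRun_cernyδ_replicate_true (n k : ℕ) (p : ZMod n) :
    dfaRun (cernyδ n) (List.replicate k true) p = p + k := by
  induction k generalizing p with
  | zero => simp [dfaRun]
  | succ k ih =>
    have h := ih (p + 1)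
    simp only [dfaRun, List.replicate_succ, List.foldl_cons, cernyδ] at h ⊢
    rw [h]
    push_cast
    ring

theorem ZMod.natCast_ne_zero_of_pos_of_lt {n m : ℕ} (h0 : 0 < m) (hm : m < n) :
    (m : ZMod n) ≠ 0 := by
  rw [Ne, ZMod.natCast_eq_zero_iff]
  exact Nat.not_dvd_of_pos_of_lt h0 hm

theorem dfaRun_cernyδ_block (n m : ℕ) (hm : 1 ≤ m) (hmn : m ≤ n) :
    dfaRun (cernyδ n) (List.replicate (n - 1) true ++ [false]) (m : ZMod n) =
      if m = 1 then 1 else ((m - 1 : ℕ) : ZMod n) := by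
  have key : (m : ZMod n) + ((n - 1 : ℕ) : ZMod n) = ((m - 1 : ℕ) : ZMod n) := by
    rw [Nat.cast_sub (by omega), Nat.cast_sub hm, ZMod.natCast_self]
    push_cast
    ring
  rw [dfaRun_append, dfaRun_cernyδ_replicate_true, key]
  rcases eq_or_ne m 1 with rfl | h
  · simp [dfaRun, cernyδ]
  · have := ZMod.natCast_ne_zero_of_pos_of_lt (n := n) (m := m - 1) (by omega) (by omega)
    simp only [dfaRun, List.foldl_cons, List.foldl_nil, cernyδ]
    rw [if_neg this, if_neg h]

theorem dfaRun_cernyδ_blocks (n k m : ℕ) (hk : k + 2 ≤ n) (hm : 1 ≤ m) (hmk : m ≤ k + 1) :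
    dfaRun (cernyδ n)
      (List.replicate k (List.replicate (n - 1) true ++ [false])).flatten (m : ZMod n) = 1 := by
  induction k generalizing m with
  | zero =>
    obtain rfl : m = 1 := by omega
    simp [dfaRun]
  | succ k ih =>
    rw [List.replicate_succ, List.flatten_cons, dfaRun_append,
      dfaRun_cernyδ_block n m hm (by omega)]
    split_ifs with h
    · simpa using ih 1 (by omega) le_rfl (by omega)
    · exact ih (m - 1) (by omega) (by omega) (by omega)

theorem dfaRun_cernyδ_cernyWord (n : ℕ) (hn : 2 ≤ n) (p : ZMod n) :
    dfaRun (cernyδ n) (cernyWord n) p = 1 := by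
  have : NeZero n := ⟨by omega⟩
  have hb : ∃ m : ℕ, 1 ≤ m ∧ m ≤ n - 2 + 1 ∧ cernyδ n false p = m := by
    by_cases hp : p = 0
    · exact ⟨1, le_rfl, by omega, by simp [cernyδ, hp]⟩
    · refine ⟨p.val, ?_, ?_, by simp [cernyδ, hp]⟩
      · exact ZMod.val_pos.2 hp
      · have := p.val_lt
        omega
  obtain ⟨m, hm, hmn, h⟩ := hb
  have := dfaRun_cernyδ_blocks n (n - 2) m (by omega) hm hmn
  rw [← h] at this
  exact this

theorem length_cernyWord (n : ℕ) (hn : 2 ≤ n) : (cernyWord n).length = (n - 1) ^ 2 := by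
  obtain ⟨k, rfl⟩ := Nat.exists_eq_add_of_le hn
  have h1 : 2 + k - 2 = k := by omega
  have h2 : 2 + k - 1 = k + 1 := by omega
  simp [cernyWord, h1, h2]
  ring

theorem mem_range_dfaRun_append_singleton {Q A : Type*} (δ : A → Q → Q) (u : List A) (x : A)
    (q : Q) : q ∈ Set.range (dfaRun δ (u ++ [x])) ↔ ∃ p ∈ Set.range (dfaRun δ u), δ x p = q := by
  simp [dfaRun]

/-- If the image of a word of the Černý automaton contains `e` but none of the `d` states
preceding `e`, then `n * d + r ≤ n + length`, where `r ∈ [1, n]` represents `e`. -/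
theorem gap_weight_le (n : ℕ) (hn : 2 ≤ n) (u : List Bool) (d : ℕ) (e : ZMod n)
    (he : e ∈ Set.range (dfaRun (cernyδ n) u))
    (hgap : ∀ j : ℕ, 1 ≤ j → j ≤ d → e - j ∉ Set.range (dfaRun (cernyδ n) u)) :
    n * d + ((e - 1).val + 1) ≤ n + u.length := by
  have : NeZero n := ⟨by omega⟩
  have : Fact (1 < n) := ⟨by omega⟩
  induction u using List.reverseRecOn generalizing d e with
  | nil =>
    rcases Nat.eq_zero_or_pos d with rfl | hd
    · have := (e - 1).val_lt
      simp
      omega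
    · exact absurd ⟨_, rfl⟩ (hgap 1 le_rfl hd)
  | append_singleton u x ih =>
    have hdn : d < n := by
      by_contra! h
      exact hgap n (by omega) h (by simpa using he)
    simp only [mem_range_dfaRun_append_singleton] at he hgap
    generalize Set.range (dfaRun (cernyδ n) u) = S at *
    rw [List.length_append, List.length_singleton]
    cases x with
    | true =>
      obtain ⟨p, hp, rfl⟩ := he
      have h := ih d p hp fun j h1 h2 hj => hgap j h1 h2 ⟨_, hj, by simp only [cernyδ]; ring⟩
      have hval : (cernyδ n true p - 1).val ≤ (p - 1).val + 1 := by
        have h1 : cernyδ n true p - 1 = (p - 1) + 1 := by simp only [cernyδ]; ring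
        have h2 := ZMod.val_add_le (p - 1) 1
        rwa [ZMod.val_one, ← h1] at h2
      omega
    | false =>
      have fixed : ∀ q : ZMod n, q ≠ 0 → q ∈ S → ∃ p ∈ S, cernyδ n false p = q :=
        fun q h0 hq => ⟨q, hq, by simp [cernyδ, h0]⟩
      have moved : (0 : ZMod n) ∈ S → ∃ p ∈ S, cernyδ n false p = 1 :=
        fun h => ⟨0, h, by simp [cernyδ]⟩
      by_cases he1 : e = 1
      · subst he1
        rcases d with _ | d
        · simp
          omega
        · by_cases h0 : (0 : ZMod n) ∈ S
          · have h := ih d 0 h0 fun j h1 h2 hj => hgap (j + 1) (by omega) (by omega) <| by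
              have hj0 := ZMod.natCast_ne_zero_of_pos_of_lt (n := n) (m := j) h1 (by omega)
              have : (1 : ZMod n) - ((j + 1 : ℕ) : ZMod n) = 0 - j := by push_cast; ring
              rw [this]
              exact fixed _ (by simpa using hj0) hj
            have hval : ((0 : ZMod n) - 1).val = n - 1 := by
              rw [zero_sub, ZMod.val_neg_of_ne_zero, ZMod.val_one]
            rw [hval] at h
            rw [sub_self, ZMod.val_zero, Nat.mul_succ]
            omega
          · have h1 : (1 : ZMod n) ∈ S := by
              obtain ⟨p, hp, hp1⟩ := he
              have hp0 : p ≠ 0 := fun h => h0 (h ▸ hp)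
              rw [cernyδ, if_neg hp0] at hp1
              exact hp1 ▸ hp
            have h := ih (d + 1) 1 h1 fun j hj1 hj2 hj =>
              hgap j hj1 hj2 (fixed _ (fun h => h0 (h ▸ hj)) hj)
            omega
      · have heS : e ∈ S := by
          obtain ⟨p, hp, rfl⟩ := he
          by_cases hp0 : p = 0
          · simp [cernyδ, hp0] at he1
          · simpa [cernyδ, hp0] using hp
        have h := ih d e heS fun j h1 h2 hj => by
          by_cases h0 : e - j = 0
          · have hj1 : j ≠ 1 := by
              rintro rfl
              exact he1 (by simpa [sub_eq_zero] using h0)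
            refine hgap (j - 1) (by omega) (by omega) ?_
            have : e - ((j - 1 : ℕ) : ZMod n) = 1 := by
              rw [Nat.cast_sub h1, sub_eq_zero.1 h0]
              simp
            rw [this]
            exact moved (h0 ▸ hj)
          · exact hgap j h1 h2 (fixed _ h0 hj)
        omega

theorem le_length_of_synchronizing (n : ℕ) (hn : 2 ≤ n) (s : List Bool) (q : ZMod n)
    (hs : ∀ p : ZMod n, dfaRun (cernyδ n) s p = q) : (n - 1) ^ 2 ≤ s.length := by
  have h := gap_weight_le n hn s (n - 1) q ⟨0, hs 0⟩ fun j h1 h2 ⟨p, hp⟩ =>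
    ZMod.natCast_ne_zero_of_pos_of_lt (n := n) (m := j) h1 (by omega) <| by
      rw [hs p] at hp
      exact sub_eq_self.1 hp.symm
  obtain ⟨k, rfl⟩ := Nat.exists_eq_add_of_le hn
  have h2 : 2 + k - 1 = k + 1 := by omega
  rw [h2] at h ⊢
  nlinarith

/-- For `n ≥ 2` the word `b(a^{n-1}b)^{n-2}` synchronizes the Černý automaton, has length
`(n-1)^2`, and every synchronizing word of this automaton has length at least `(n-1)^2`. -/
theorem cerny_automaton (n : ℕ) (hn : 2 ≤ n) :
    (∃ q : ZMod n, ∀ p : ZMod n, dfaRun (cernyδ n) (cernyWord n) p = q) ∧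
    (cernyWord n).length = (n - 1) ^ 2 ∧
    ∀ s : List Bool, (∃ q : ZMod n, ∀ p : ZMod n, dfaRun (cernyδ n) s p = q) →
      (n - 1) ^ 2 ≤ s.length := by
  exact ⟨⟨1, dfaRun_cernyδ_cernyWord n hn⟩, length_cernyWord n hn,
    fun s ⟨q, hq⟩ => le_length_of_synchronizing n hn s q hq⟩
end
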